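/- There exist absolute constants C and s such that the following holds. Let τ ≥ 1, let k, n, p be positive integers and γ a real with 1 ≤ γ ≤ min{k^{1/4}, √n}, p = ⌈1.1·γn⌉, and k ≥ C·γ^{7/6}·√n·τ^s. Suppose X₁,…,X_p ∈ ℝ^n satisfy the pseudorandomness condition with parameter τ and some slack ε ∈ (0,1). Then the degree-4 array P satisfies: (a) the p²×p² matrix with entries P(x_i x_j x_s x_t) in position ((i,j),(s,t)) is positive semidefinite; (b) for all i,j ∈ [p], P(x_i³ x_j) = M̃(x_i x_j) + F_{ij}, where the p×p matrix F satisfies 0 ≤ F_{ii} ≤ C·τ⁴·γk/(pn) for all i and |F_{ij}| ≤ C·τ⁴·γk/(p·n^{3/2}) for all i ≠ j; (c) the p×p matrix E defined by E_{st} = Σ_{i∈[p]} P(x_i² x_s x_t) is positive semidefinite and satisfies E_{ss} ≤ C·τ²·γk/n for all s and |E_{st}| ≤ C·τ²·γk/n^{3/2} for all s ≠ t; (d) Σ_{i,j,s,t∈[p]} |P(x_i x_j x_s x_t)| ≤ k⁴/3. -/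

import Mathlib

open scoped BigOperators

noncomputable section

/-- Euclidean inner product on `ℝⁿ`. -/
def dotR {n : ℕ} (x y : Fin n → ℝ) : ℝ := ∑ a, x a * y a

/-- The pseudorandomness condition (P1)-(P7) on the (scaled) data vectors `X₁, …, X_p ∈ ℝⁿ`,
with parameter `τ ≥ 1` and slack `ε ∈ (0,1)`. -/
def PseudoRandom (n p : ℕ) (X : Fin p → Fin n → ℝ) (τ ε : ℝ) : Prop :=
  (∀ i, dotR (X i) (X i) = n) ∧
  (∀ i j, i ≠ j → |dotR (X i) (X j)| ≤ τ * Real.sqrt n) ∧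
  (∀ i j, i ≠ j →
    |∑ l ∈ Finset.univ \ {i, j}, (dotR (X i) (X l)) ^ 3 * dotR (X j) (X l)| ≤
      τ * (n : ℝ) ^ ((3 : ℝ) / 2) * p) ∧
  (∀ i j s t : Fin p, i ≠ j → i ≠ s → i ≠ t → j ≠ s → j ≠ t → s ≠ t →
    |∑ l, dotR (X i) (X l) * dotR (X j) (X l) * dotR (X s) (X l) * dotR (X t) (X l)| ≤
      τ * (n : ℝ) ^ 2 * Real.sqrt p) ∧
  (∀ s t, s ≠ t → |∑ i, dotR (X i) (X s) * dotR (X i) (X t)| ≤ τ * Real.sqrt n * p) ∧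
  (∀ s t, s ≠ t →
    |∑ i, ∑ l, (dotR (X i) (X l)) ^ 2 * dotR (X s) (X l) * dotR (X t) (X l)| ≤
      τ * (n : ℝ) ^ ((3 : ℝ) / 2) * (p : ℝ) ^ 2) ∧
  ((1 - ε) * n * (p : ℝ) ^ 2 ≤ ∑ i, ∑ j, (dotR (X i) (X j)) ^ 2)

/-- The degree-2 pseudo-moments `M̃(x_i x_j) = (γ k / p²) ⟨X_i, X_j⟩`. -/
def tM (n p : ℕ) (X : Fin p → Fin n → ℝ) (γ k : ℝ) (i j : Fin p) : ℝ :=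
  γ * k / (p : ℝ) ^ 2 * dotR (X i) (X j)

/-- The degree-4 array `P(x_i x_j x_s x_t)`. -/
def Parr (n p : ℕ) (X : Fin p → Fin n → ℝ) (γ k : ℝ) (i j s t : Fin p) : ℝ :=
  γ * k / ((p : ℝ) ^ 2 * (n : ℝ) ^ 3) *
    ∑ l, dotR (X i) (X l) * dotR (X j) (X l) * dotR (X s) (X l) * dotR (X t) (X l)

section Helpers

variable {n p : ℕ} {X : Fin p → Fin n → ℝ} {γ τ ε κ : ℝ}

lemma dotR_comm (x y : Fin n → ℝ) : dotR x y = dotR y x :=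
  Finset.sum_congr rfl fun _ _ => mul_comm _ _

lemma dotR_sq_le (x y : Fin n → ℝ) : dotR x y ^ 2 ≤ dotR x x * dotR y y := by
  simpa only [dotR, sq] using Finset.sum_mul_sq_le_sq_mul_sq Finset.univ x y

lemma dotR_sum_right {ι : Type*} [Fintype ι] (x : Fin n → ℝ) (c : ι → ℝ) (Y : ι → Fin n → ℝ) :
    dotR x (fun a => ∑ i, c i * Y i a) = ∑ i, c i * dotR x (Y i) := by
  simp only [dotR, Finset.mul_sum]
  rw [Finset.sum_comm]
  refine Finset.sum_congr rfl fun i _ => Finset.sum_congr rfl fun a _ => by ring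

/-- Cauchy-Schwarz applied to `x` and `∑ i, ⟨x, X_i⟩ X_i`. -/
lemma sum_dotR_sq_sq_le (x : Fin n → ℝ) (X : Fin p → Fin n → ℝ) :
    (∑ i, dotR x (X i) ^ 2) ^ 2 ≤
      dotR x x * ∑ i, dotR x (X i) * ∑ j, dotR x (X j) * dotR (X i) (X j) := by
  have h := dotR_sq_le x (fun a => ∑ i, dotR x (X i) * X i a)
  have h1 : dotR (fun a => ∑ i, dotR x (X i) * X i a) (fun a => ∑ i, dotR x (X i) * X i a) =
      ∑ i, dotR x (X i) * ∑ j, dotR x (X j) * dotR (X i) (X j) := by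
    rw [dotR_sum_right]
    refine Finset.sum_congr rfl fun i _ => ?_
    rw [dotR_comm (fun a => ∑ i, dotR x (X i) * X i a) (X i), dotR_sum_right]
  rw [dotR_sum_right, h1] at h
  simpa only [sq] using h

lemma PseudoRandom.sum_sq_le (h : PseudoRandom n p X τ ε) (hn : 0 < n) (hnp : n ≤ p)
    (hτ : 1 ≤ τ) (s : Fin p) :
    ∑ i, dotR (X i) (X s) ^ 2 ≤ 2 * τ * n * p := by
  obtain ⟨h1, -, -, -, h5, -, -⟩ := h
  have hn0 : (0 : ℝ) < n := by exact_mod_cast hn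
  have hnp' : (n : ℝ) ≤ p := by exact_mod_cast hnp
  have hp0 : (0 : ℝ) < p := hn0.trans_le hnp'
  simp only [fun i => dotR_comm (X i) (X s)]
  set A := ∑ i, dotR (X s) (X i) ^ 2 with hA
  by_contra! hlt
  set R := ∑ i ∈ Finset.univ.erase s, dotR (X s) (X i) * ∑ j, dotR (X s) (X j) * dotR (X i) (X j)
    with hR
  have hCS : A ^ 2 ≤ n * (n * A + R) := by
    have hcs := sum_dotR_sq_sq_le (X s) X
    have hsplit : ∑ i, dotR (X s) (X i) * ∑ j, dotR (X s) (X j) * dotR (X i) (X j) =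
        n * A + R := by
      rw [← Finset.add_sum_erase _ _ (Finset.mem_univ s), h1]
      simp only [hA, hR, sq]
    rwa [hsplit, h1] at hcs
  have hRle : R ^ 2 ≤ A * (p * (τ ^ 2 * n * p ^ 2)) := by
    refine (Finset.sum_mul_sq_le_sq_mul_sq _ _ _).trans ?_
    have e1 : ∑ i ∈ Finset.univ.erase s, dotR (X s) (X i) ^ 2 ≤ A :=
      Finset.sum_le_sum_of_subset_of_nonneg (Finset.erase_subset _ _) fun _ _ _ => sq_nonneg _
    have e2 : ∑ i ∈ Finset.univ.erase s, (∑ j, dotR (X s) (X j) * dotR (X i) (X j)) ^ 2 ≤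
        p * (τ ^ 2 * n * p ^ 2) := by
      calc _ ≤ ∑ i ∈ Finset.univ.erase s, (τ ^ 2 * n * p ^ 2 : ℝ) := by
            refine Finset.sum_le_sum fun i hi => ?_
            have := h5 s i (Finset.ne_of_mem_erase hi).symm
            simp only [fun j => dotR_comm (X j) (X s), fun j => dotR_comm (X j) (X i)] at this
            calc _ ≤ (τ * √n * p) ^ 2 := sq_le_sq' (abs_le.1 this).1 (abs_le.1 this).2
              _ = _ := by rw [mul_pow, mul_pow, Real.sq_sqrt hn0.le]
        _ ≤ ∑ i : Fin p, (τ ^ 2 * n * p ^ 2 : ℝ) :=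
            Finset.sum_le_sum_of_subset_of_nonneg (Finset.erase_subset _ _)
              fun _ _ _ => by positivity
        _ = _ := by simp
    have : 0 ≤ A := Finset.sum_nonneg fun _ _ => sq_nonneg _
    gcongr
  have hA0 : 0 < A := lt_trans (by positivity) hlt
  have hn2 : (n : ℝ) ^ 2 ≤ A / 2 := by
    have : (n : ℝ) * n ≤ τ * n * p := by
      calc (n : ℝ) * n ≤ n * p := by gcongr
        _ ≤ τ * (n * p) := le_mul_of_one_le_left (by positivity) hτ
        _ = _ := by ring
    nlinarith
  have hlow : A ^ 2 / 2 ≤ n * R := by nlinarith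
  have hsq : (A ^ 2 / 2) ^ 2 ≤ (n * R) ^ 2 := by gcongr
  have hup : (n * R) ^ 2 ≤ A * (τ * n * p) ^ 3 := by
    calc (n * R) ^ 2 = n ^ 2 * R ^ 2 := by ring
      _ ≤ n ^ 2 * (A * (p * (τ ^ 2 * n * p ^ 2))) := by gcongr
      _ = (A * (τ ^ 2 * n ^ 3 * p ^ 3)) * 1 := by ring
      _ ≤ (A * (τ ^ 2 * n ^ 3 * p ^ 3)) * τ := by gcongr
      _ = _ := by ring
  have hcube : (τ * n * p) ^ 3 ≤ (A / 2) ^ 3 := by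
    gcongr
    linarith
  have : A * (τ * n * p) ^ 3 ≤ A * (A / 2) ^ 3 := by gcongr
  have : 0 < A ^ 4 := by positivity
  nlinarith

lemma posSemidef_of_smul_gram {ι κ : Type*} [Fintype ι] [Fintype κ] {c : ℝ} (hc : 0 ≤ c)
    (B : Matrix ι κ ℝ) (M : Matrix ι ι ℝ) (h : ∀ i j, M i j = c * ∑ l, B i l * B j l) :
    M.PosSemidef := by
  have : M = c • (B * B.conjTranspose) := by
    ext i j
    simp [h, Matrix.mul_apply]
  rw [this]
  exact (Matrix.posSemidef_self_mul_conjTranspose B).smul hc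

lemma posSemidef_Parr (hc : 0 ≤ γ * κ) :
    (Matrix.of fun (ij st : Fin p × Fin p) =>
      Parr n p X γ κ ij.1 ij.2 st.1 st.2).PosSemidef := by
  refine posSemidef_of_smul_gram (c := γ * κ / ((p : ℝ) ^ 2 * (n : ℝ) ^ 3)) (by positivity)
    (Matrix.of fun ij l => dotR (X ij.1) (X l) * dotR (X ij.2) (X l)) _ fun ij st => ?_
  simp only [Matrix.of_apply, Parr]
  congr 1
  exact Finset.sum_congr rfl fun l _ => by ring

lemma sum_Parr (s t : Fin p) :
    ∑ i, Parr n p X γ κ i i s t = γ * κ / ((p : ℝ) ^ 2 * (n : ℝ) ^ 3) *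
      ∑ i, ∑ l, dotR (X i) (X l) ^ 2 * dotR (X s) (X l) * dotR (X t) (X l) := by
  simp only [Parr, ← Finset.mul_sum, sq]

lemma posSemidef_sum_Parr (hc : 0 ≤ γ * κ) :
    (Matrix.of fun s t => ∑ i, Parr n p X γ κ i i s t).PosSemidef := by
  refine posSemidef_of_smul_gram (c := γ * κ / ((p : ℝ) ^ 2 * (n : ℝ) ^ 3)) (by positivity)
    (Matrix.of fun s (il : Fin p × Fin p) => dotR (X il.1) (X il.2) * dotR (X s) (X il.2))
    _ fun s t => ?_
  simp only [Matrix.of_apply, sum_Parr, Fintype.sum_prod_type]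
  congr 1
  exact Finset.sum_congr rfl fun i _ => Finset.sum_congr rfl fun l _ => by ring

lemma Parr_diag_sub_tM (h : PseudoRandom n p X τ ε) (hn : 0 < n) (hp : 0 < p)
    (i : Fin p) :
    Parr n p X γ κ i i i i - tM n p X γ κ i i = γ * κ / ((p : ℝ) ^ 2 * (n : ℝ) ^ 3) *
      ∑ l ∈ Finset.univ.erase i, dotR (X i) (X l) ^ 4 := by
  have hn0 : (n : ℝ) ≠ 0 := by positivity
  have hp0 : (p : ℝ) ≠ 0 := by positivity
  have e : ∀ l, dotR (X i) (X l) * dotR (X i) (X l) * dotR (X i) (X l) * dotR (X i) (X l) =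
      dotR (X i) (X l) ^ 4 := fun l => by ring
  simp only [Parr, tM, e]
  rw [← Finset.add_sum_erase _ _ (Finset.mem_univ i), h.1]
  field_simp
  ring

lemma PseudoRandom.sum_erase_pow_four_le (h : PseudoRandom n p X τ ε) (i : Fin p) :
    ∑ l ∈ Finset.univ.erase i, dotR (X i) (X l) ^ 4 ≤ p * (τ ^ 4 * n ^ 2) := by
  calc _ ≤ ∑ l ∈ Finset.univ.erase i, (τ ^ 4 * n ^ 2 : ℝ) := by
        refine Finset.sum_le_sum fun l hl => ?_
        have := h.2.1 i l (Finset.ne_of_mem_erase hl).symm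
        calc dotR (X i) (X l) ^ 4 = |dotR (X i) (X l)| ^ 4 := by
              rw [Even.pow_abs (by decide)]
          _ ≤ (τ * √n) ^ 4 := by gcongr
          _ = τ ^ 4 * (√n ^ 2) ^ 2 := by ring
          _ = _ := by rw [Real.sq_sqrt (by positivity)]
    _ ≤ ∑ l : Fin p, (τ ^ 4 * n ^ 2 : ℝ) :=
        Finset.sum_le_sum_of_subset_of_nonneg (Finset.erase_subset _ _)
          fun _ _ _ => by positivity
    _ = _ := by simp

lemma Parr_offdiag_sub_tM (h : PseudoRandom n p X τ ε) (hn : 0 < n) (hp : 0 < p)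
    {i j : Fin p} (hij : i ≠ j) :
    Parr n p X γ κ i i i j - tM n p X γ κ i j = γ * κ / ((p : ℝ) ^ 2 * (n : ℝ) ^ 3) *
      (n * dotR (X i) (X j) ^ 3 +
        ∑ l ∈ Finset.univ \ {i, j}, dotR (X i) (X l) ^ 3 * dotR (X j) (X l)) := by
  have hn0 : (n : ℝ) ≠ 0 := by positivity
  have hp0 : (p : ℝ) ≠ 0 := by positivity
  have e : ∀ l, dotR (X i) (X l) * dotR (X i) (X l) * dotR (X i) (X l) * dotR (X j) (X l) =
      dotR (X i) (X l) ^ 3 * dotR (X j) (X l) := fun l => by ring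
  simp only [Parr, tM, e]
  rw [← Finset.sum_sdiff (Finset.subset_univ {i, j}), Finset.sum_pair hij, h.1, h.1,
    dotR_comm (X j) (X i)]
  field_simp
  ring

lemma rpow_three_halves {x : ℝ} (hx : 0 ≤ x) : x ^ ((3 : ℝ) / 2) = √x ^ 3 := by
  rw [Real.sqrt_eq_rpow, ← Real.rpow_natCast, ← Real.rpow_mul hx]
  norm_num

lemma PseudoRandom.abs_Parr_offdiag_sub_tM_le (h : PseudoRandom n p X τ ε) (hn : 0 < n)
    (hnp : n ≤ p) (hτ : 1 ≤ τ) (hc : 0 ≤ γ * κ) {i j : Fin p} (hij : i ≠ j) :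
    |Parr n p X γ κ i i i j - tM n p X γ κ i j| ≤
      2 * τ ^ 4 * γ * κ / (p * (n : ℝ) ^ ((3 : ℝ) / 2)) := by
  have hn0 : (0 : ℝ) < n := by exact_mod_cast hn
  have hnp' : (n : ℝ) ≤ p := by exact_mod_cast hnp
  have hp0 : (0 : ℝ) < p := hn0.trans_le hnp'
  have hs : 0 < √(n : ℝ) := Real.sqrt_pos.2 hn0
  rw [Parr_offdiag_sub_tM h hn (hn.trans_le hnp) hij, abs_mul, abs_of_nonneg (by positivity)]
  have h3 := h.2.2.1 i j hij
  have h2 := h.2.1 i j hij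
  rw [rpow_three_halves hn0.le] at h3 ⊢
  have hτ1 : τ ≤ τ ^ 4 := le_self_pow₀ hτ (by norm_num)
  have hτ3 : τ ^ 3 ≤ τ ^ 4 := pow_le_pow_right₀ hτ (by norm_num)
  have key : |n * dotR (X i) (X j) ^ 3 +
      ∑ l ∈ Finset.univ \ {i, j}, dotR (X i) (X l) ^ 3 * dotR (X j) (X l)| ≤
      2 * τ ^ 4 * √n ^ 3 * p := by
    calc _ ≤ |n * dotR (X i) (X j) ^ 3| + _ := abs_add_le _ _
      _ ≤ p * (τ ^ 4 * √n ^ 3) + τ ^ 4 * √n ^ 3 * p := by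
          refine add_le_add ?_ (h3.trans (by gcongr))
          rw [abs_mul, abs_pow, abs_of_pos hn0]
          calc (n : ℝ) * |dotR (X i) (X j)| ^ 3 ≤ p * (τ * √n) ^ 3 := by gcongr
            _ = p * (τ ^ 3 * √n ^ 3) := by ring
            _ ≤ _ := by gcongr
      _ = _ := by ring
  refine (mul_le_mul_of_nonneg_left key (by positivity)).trans_eq ?_
  have hsq : (n : ℝ) ^ 3 = √n ^ 6 := by
    rw [show √(n : ℝ) ^ 6 = (√n ^ 2) ^ 3 by ring, Real.sq_sqrt hn0.le]
  rw [hsq]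
  field_simp

lemma PseudoRandom.sum_Parr_diag_le (h : PseudoRandom n p X τ ε) (hn : 0 < n)
    (hnp : n ≤ p) (hτ : 1 ≤ τ) (hc : 0 ≤ γ * κ) (s : Fin p) :
    ∑ i, Parr n p X γ κ i i s s ≤ 4 * τ ^ 2 * γ * κ / n := by
  have hn0 : (0 : ℝ) < n := by exact_mod_cast hn
  have hp0 : (0 : ℝ) < p := by exact_mod_cast hn.trans_le hnp
  have key : ∑ i, ∑ l, dotR (X i) (X l) ^ 2 * dotR (X s) (X l) * dotR (X s) (X l) ≤
      (2 * τ * n * p) * (2 * τ * n * p) := by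
    rw [Finset.sum_comm]
    calc _ = ∑ l, (∑ i, dotR (X i) (X l) ^ 2) * dotR (X l) (X s) ^ 2 := by
          refine Finset.sum_congr rfl fun l _ => ?_
          rw [Finset.sum_mul]
          exact Finset.sum_congr rfl fun i _ => by rw [dotR_comm (X s)]; ring
      _ ≤ ∑ l, (2 * τ * n * p) * dotR (X l) (X s) ^ 2 := by
          gcongr with l
          exact h.sum_sq_le hn hnp hτ l
      _ ≤ _ := by
          rw [← Finset.mul_sum]
          gcongr
          exact h.sum_sq_le hn hnp hτ s
  rw [sum_Parr]
  refine (mul_le_mul_of_nonneg_left key (by positivity)).trans_eq ?_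
  field_simp
  ring

lemma PseudoRandom.abs_sum_Parr_offdiag_le (h : PseudoRandom n p X τ ε) (hn : 0 < n)
    (hp : 0 < p) (hτ : 1 ≤ τ) (hc : 0 ≤ γ * κ) {s t : Fin p} (hst : s ≠ t) :
    |∑ i, Parr n p X γ κ i i s t| ≤ τ ^ 2 * γ * κ / (n : ℝ) ^ ((3 : ℝ) / 2) := by
  have hn0 : (0 : ℝ) < n := by exact_mod_cast hn
  have hp0 : (0 : ℝ) < p := by exact_mod_cast hp
  have hs : 0 < √(n : ℝ) := Real.sqrt_pos.2 hn0
  have h6 := h.2.2.2.2.2.1 s t hst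
  rw [sum_Parr, abs_mul, abs_of_nonneg (by positivity)]
  rw [rpow_three_halves hn0.le] at h6 ⊢
  have hτ2 : τ ≤ τ ^ 2 := le_self_pow₀ hτ (by norm_num)
  have h6' := h6.trans (show _ ≤ τ ^ 2 * √(n : ℝ) ^ 3 * p ^ 2 by gcongr)
  refine (mul_le_mul_of_nonneg_left h6' (by positivity)).trans_eq ?_
  have hsq : (n : ℝ) ^ 3 = √n ^ 6 := by
    rw [show √(n : ℝ) ^ 6 = (√n ^ 2) ^ 3 by ring, Real.sq_sqrt hn0.le]
  rw [hsq]
  field_simp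

/-- The number of coinciding pairs among four indices. -/
def coincidences {ι : Type*} [DecidableEq ι] (i j s t : ι) : ℝ :=
  (if i = j then 1 else 0) + (if i = s then 1 else 0) + (if i = t then 1 else 0) +
    (if j = s then 1 else 0) + (if j = t then 1 else 0) + (if s = t then 1 else 0)

lemma sum_coincidences {ι : Type*} [Fintype ι] [DecidableEq ι] (f : ι → ℝ) :
    ∑ i, ∑ j, ∑ s, ∑ t, coincidences i j s t * (f i * f j * f s * f t) =
      6 * ((∑ i, f i ^ 2) * (∑ i, f i) ^ 2) := by
  set Q := ∑ i, f i ^ 2 with hQ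
  set S := ∑ i, f i with hS
  have c12 : ∑ i, ∑ j, ∑ s, ∑ t, (if i = j then f i * f j * f s * f t else 0) = Q * S ^ 2 := by
    calc _ = ∑ i, ∑ s, ∑ t, f i * f i * f s * f t := by
          refine Finset.sum_congr rfl fun i _ => ?_
          rw [Finset.sum_eq_single i (fun j _ hj => by simp [hj.symm]) (by simp)]
          simp
      _ = _ := by
          simp only [← Finset.mul_sum, ← Finset.sum_mul, ← hS, ← sq, ← hQ]
          ring
  have c13 : ∑ i, ∑ j, ∑ s, ∑ t, (if i = s then f i * f j * f s * f t else 0) = Q * S ^ 2 := by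
    rw [← c12]
    refine Finset.sum_congr rfl fun i _ => ?_
    rw [Finset.sum_comm]
    refine Finset.sum_congr rfl fun s _ => Finset.sum_congr rfl fun j _ =>
      Finset.sum_congr rfl fun t _ => by congr 1; ring
  have c14 : ∑ i, ∑ j, ∑ s, ∑ t, (if i = t then f i * f j * f s * f t else 0) = Q * S ^ 2 := by
    rw [← c13]
    refine Finset.sum_congr rfl fun i _ => Finset.sum_congr rfl fun j _ => ?_
    rw [Finset.sum_comm]
    refine Finset.sum_congr rfl fun s _ => Finset.sum_congr rfl fun t _ => by congr 1; ring
  have c23 : ∑ i, ∑ j, ∑ s, ∑ t, (if j = s then f i * f j * f s * f t else 0) = Q * S ^ 2 := by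
    rw [← c13, Finset.sum_comm]
    refine Finset.sum_congr rfl fun i _ => Finset.sum_congr rfl fun j _ =>
      Finset.sum_congr rfl fun s _ => Finset.sum_congr rfl fun t _ => by congr 1; ring
  have c24 : ∑ i, ∑ j, ∑ s, ∑ t, (if j = t then f i * f j * f s * f t else 0) = Q * S ^ 2 := by
    rw [← c14, Finset.sum_comm]
    refine Finset.sum_congr rfl fun i _ => Finset.sum_congr rfl fun j _ =>
      Finset.sum_congr rfl fun s _ => Finset.sum_congr rfl fun t _ => by congr 1; ring
  have c34 : ∑ i, ∑ j, ∑ s, ∑ t, (if s = t then f i * f j * f s * f t else 0) = Q * S ^ 2 := by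
    rw [← c24]
    refine Finset.sum_congr rfl fun i _ => ?_
    rw [Finset.sum_comm]
    refine Finset.sum_congr rfl fun j _ => Finset.sum_congr rfl fun s _ =>
      Finset.sum_congr rfl fun t _ => by congr 1; ring
  simp only [coincidences, add_mul, ite_mul, one_mul, zero_mul, Finset.sum_add_distrib,
    c12, c13, c14, c23, c24, c34]
  ring

lemma PseudoRandom.sum_abs_le (h : PseudoRandom n p X τ ε) (hn : 0 < n) (hnp : n ≤ p)
    (hτ : 1 ≤ τ) (l : Fin p) :
    ∑ i, |dotR (X i) (X l)| ≤ 2 * τ * p * √n := by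
  have hn0 : (0 : ℝ) < n := by exact_mod_cast hn
  have hnp' : (n : ℝ) ≤ p := by exact_mod_cast hnp
  have hs1 : 1 ≤ √(n : ℝ) := Real.one_le_sqrt.2 (by exact_mod_cast hn)
  rw [← Finset.add_sum_erase _ _ (Finset.mem_univ l), h.1, abs_of_pos hn0]
  have e1 : (n : ℝ) ≤ τ * p * √n := by
    calc (n : ℝ) = 1 * n * 1 := by ring
      _ ≤ τ * p * √n := by gcongr
  have e2 : ∑ i ∈ Finset.univ.erase l, |dotR (X i) (X l)| ≤ τ * p * √n := by
    calc _ ≤ ∑ i ∈ Finset.univ.erase l, τ * √n :=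
          Finset.sum_le_sum fun i hi => h.2.1 i l (Finset.ne_of_mem_erase hi)
      _ ≤ ∑ i : Fin p, τ * √n :=
          Finset.sum_le_sum_of_subset_of_nonneg (Finset.erase_subset _ _)
            fun _ _ _ => by positivity
      _ = _ := by simp; ring
  linarith

lemma PseudoRandom.abs_sum_le (h : PseudoRandom n p X τ ε) (hτ : 1 ≤ τ) (i j s t : Fin p) :
    |∑ l, dotR (X i) (X l) * dotR (X j) (X l) * dotR (X s) (X l) * dotR (X t) (X l)| ≤
      τ * n ^ 2 * √p + ∑ l, coincidences i j s t * (|dotR (X i) (X l)| * |dotR (X j) (X l)| *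
        |dotR (X s) (X l)| * |dotR (X t) (X l)|) := by
  have hτn : 0 ≤ τ * (n : ℝ) ^ 2 * √p := by positivity
  by_cases hd : i ≠ j ∧ i ≠ s ∧ i ≠ t ∧ j ≠ s ∧ j ≠ t ∧ s ≠ t
  · obtain ⟨a, b, c, d, e, f⟩ := hd
    simpa [coincidences, a, b, c, d, e, f] using h.2.2.2.1 i j s t a b c d e f
  · have hco : 1 ≤ coincidences i j s t := by
      have h0 : ∀ (q : Prop) [Decidable q], (0 : ℝ) ≤ if q then 1 else 0 := fun q _ => by
        split_ifs <;> norm_num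
      have := h0 (i = j)
      have := h0 (i = s)
      have := h0 (i = t)
      have := h0 (j = s)
      have := h0 (j = t)
      have := h0 (s = t)
      rw [coincidences]
      by_contra! hlt
      refine hd ⟨?_, ?_, ?_, ?_, ?_, ?_⟩ <;> intro heq <;> rw [if_pos heq] at hlt <;> linarith
    refine le_add_of_nonneg_of_le hτn ((Finset.abs_sum_le_sum_abs _ _).trans ?_)
    refine Finset.sum_le_sum fun l _ => ?_
    rw [abs_mul, abs_mul, abs_mul]
    exact le_mul_of_one_le_left (by positivity) hco

lemma PseudoRandom.sum_abs_Parr_le (h : PseudoRandom n p X τ ε) (hn : 0 < n) (hnp : n ≤ p)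
    (hτ : 1 ≤ τ) (hc : 0 ≤ γ * κ) :
    ∑ i, ∑ j, ∑ s, ∑ t, |Parr n p X γ κ i j s t| ≤
      γ * κ * p ^ 2 / n * (τ * √p + 48 * τ ^ 3) := by
  have hn0 : (0 : ℝ) < n := by exact_mod_cast hn
  have hp0 : (0 : ℝ) < p := by exact_mod_cast hn.trans_le hnp
  have hcoin : ∑ i, ∑ j, ∑ s, ∑ t, ∑ l, coincidences i j s t *
      (|dotR (X i) (X l)| * |dotR (X j) (X l)| * |dotR (X s) (X l)| * |dotR (X t) (X l)|) ≤
      p * (6 * ((2 * τ * n * p) * (2 * τ * p * √n) ^ 2)) := by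
    calc _ = ∑ l, ∑ i, ∑ j, ∑ s, ∑ t, coincidences i j s t *
          (|dotR (X i) (X l)| * |dotR (X j) (X l)| * |dotR (X s) (X l)| * |dotR (X t) (X l)|) := by
          symm
          rw [Finset.sum_comm]
          refine Finset.sum_congr rfl fun i _ => ?_
          rw [Finset.sum_comm]
          refine Finset.sum_congr rfl fun j _ => ?_
          rw [Finset.sum_comm]
          refine Finset.sum_congr rfl fun s _ => Finset.sum_comm
      _ = ∑ l, 6 * ((∑ i, |dotR (X i) (X l)| ^ 2) * (∑ i, |dotR (X i) (X l)|) ^ 2) :=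
          Finset.sum_congr rfl fun l _ => sum_coincidences fun i => |dotR (X i) (X l)|
      _ ≤ ∑ l : Fin p, 6 * ((2 * τ * n * p) * (2 * τ * p * √n) ^ 2) := by
          refine Finset.sum_le_sum fun l _ => ?_
          have h1 := h.sum_abs_le hn hnp hτ l
          have h2 := h.sum_sq_le hn hnp hτ l
          simp only [sq_abs]
          gcongr
      _ = _ := by simp
  have hS : ∑ i, ∑ j, ∑ s, ∑ t,
      |∑ l, dotR (X i) (X l) * dotR (X j) (X l) * dotR (X s) (X l) * dotR (X t) (X l)| ≤
      p ^ 4 * (τ * n ^ 2 * √p) + p * (6 * ((2 * τ * n * p) * (2 * τ * p * √n) ^ 2)) := by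
    calc _ ≤ ∑ i : Fin p, ∑ j : Fin p, ∑ s : Fin p, ∑ t : Fin p, (τ * n ^ 2 * √p +
          ∑ l, coincidences i j s t * (|dotR (X i) (X l)| * |dotR (X j) (X l)| *
            |dotR (X s) (X l)| * |dotR (X t) (X l)|)) := by
          gcongr with i _ j _ s _ t _
          exact h.abs_sum_le hτ i j s t
      _ ≤ _ := by
          simp only [Finset.sum_add_distrib]
          refine add_le_add (le_of_eq ?_) hcoin
          simp only [Finset.sum_const, Finset.card_univ, Fintype.card_fin, nsmul_eq_mul]
          ring
  simp only [Parr, abs_mul, ← Finset.mul_sum]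
  rw [abs_of_nonneg (by positivity)]
  refine (mul_le_mul_of_nonneg_left hS (by positivity)).trans_eq ?_
  have hsq : (2 * τ * p * √n) ^ 2 = 4 * τ ^ 2 * p ^ 2 * (n : ℝ) := by
    rw [mul_pow, Real.sq_sqrt hn0.le]; ring
  rw [hsq]
  field_simp
  ring

/-- `k ≥ 10 γ^{7/6} √n τ` dominates the ℓ¹ bound. -/
lemma l1_bound_le {n p k : ℝ} (hn : 1 ≤ n) (hk : 0 ≤ k) (hτ : 1 ≤ τ) (hγ : 1 ≤ γ)
    (hp0 : 0 ≤ p) (hp : p ≤ 2.1 * γ * n)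
    (hkC : 10 * γ ^ ((7 : ℝ) / 6) * √n * τ ^ (1 : ℝ) ≤ k) :
    γ * k * p ^ 2 / n * (τ * √p + 48 * τ ^ 3) ≤ k ^ 4 / 3 := by
  have hγ0 : 0 < γ := by linarith
  have hn0 : 0 < n := by linarith
  have hX : (10 * γ ^ ((7 : ℝ) / 6) * √n * τ ^ (1 : ℝ)) ^ 3 =
      1000 * (γ ^ 3 * √γ) * (n * √n) * τ ^ 3 := by
    have e1 : (γ ^ ((7 : ℝ) / 6)) ^ 3 = γ ^ 3 * √γ := by
      rw [Real.sqrt_eq_rpow, ← Real.rpow_natCast, ← Real.rpow_mul hγ0.le,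
        ← Real.rpow_natCast, ← Real.rpow_add hγ0]
      norm_num
    have e2 : √n ^ 3 = n * √n := by
      rw [pow_succ, Real.sq_sqrt hn0.le]
    rw [Real.rpow_one, mul_pow, mul_pow, mul_pow, e1, e2]
    norm_num
  have hk3 : 1000 * (γ ^ 3 * √γ) * (n * √n) * τ ^ 3 ≤ k ^ 3 := by
    rw [← hX]
    gcongr
  have hsγ : 1 ≤ √γ := Real.one_le_sqrt.2 hγ
  have hsn : 1 ≤ √n := Real.one_le_sqrt.2 hn
  have hsp : √p ≤ 1.5 * (√γ * √n) := by
    rw [← Real.sqrt_mul hγ0.le]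
    refine Real.sqrt_le_iff.2 ⟨by positivity, ?_⟩
    rw [mul_pow, Real.sq_sqrt (by positivity)]
    nlinarith [mul_pos hγ0 hn0]
  have hbr : τ * √p + 48 * τ ^ 3 ≤ 49.5 * (√γ * √n) * τ ^ 3 := by
    have hτ3 : τ ≤ τ ^ 3 := le_self_pow₀ hτ (by norm_num)
    have h1 : τ * √p ≤ τ ^ 3 * (1.5 * (√γ * √n)) := by gcongr
    have h2 : τ ^ 3 * 1 ≤ τ ^ 3 * (√γ * √n) := by
      gcongr
      exact one_le_mul_of_one_le_of_one_le hsγ hsn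
    linarith
  have hpn : γ * k * p ^ 2 / n ≤ 4.41 * k * γ ^ 3 * n := by
    rw [div_le_iff₀ hn0]
    calc γ * k * p ^ 2 ≤ γ * k * (2.1 * γ * n) ^ 2 := by gcongr
      _ = _ := by ring
  calc _ ≤ (4.41 * k * γ ^ 3 * n) * (49.5 * (√γ * √n) * τ ^ 3) := by gcongr
    _ = k * (0.218295 * (1000 * (γ ^ 3 * √γ) * (n * √n) * τ ^ 3)) := by ring
    _ ≤ k * (0.218295 * k ^ 3) := by gcongr
    _ ≤ k ^ 4 / 3 := by
      have : 0 ≤ k ^ 4 := by positivity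
      nlinarith

end Helpers

/-- Lemma `lem:P`: properties of the degree-4 moments `P`. -/
theorem Parr_properties :
    ∃ C s : ℝ, 0 < C ∧ 0 < s ∧
      ∀ (n p k : ℕ) (γ τ ε : ℝ),
        0 < n → 0 < k →
        1 ≤ τ → 1 ≤ γ → γ ≤ (k : ℝ) ^ ((1 : ℝ) / 4) → γ ≤ Real.sqrt n →
        p = ⌈(1.1 : ℝ) * γ * n⌉₊ →
        C * γ ^ ((7 : ℝ) / 6) * Real.sqrt n * τ ^ s ≤ (k : ℝ) →
        0 < ε → ε < 1 →
        ∀ X : Fin p → Fin n → ℝ, PseudoRandom n p X τ ε →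
        -- (a) PSDness of the p² × p² matrix form of P
        (Matrix.of fun (ij st : Fin p × Fin p) =>
            Parr n p X γ k ij.1 ij.2 st.1 st.2).PosSemidef ∧
        -- (b) P(x_i³ x_j) = M̃(x_i x_j) + F_{ij} with F small
        ((∀ i, 0 ≤ Parr n p X γ k i i i i - tM n p X γ k i i ∧
            Parr n p X γ k i i i i - tM n p X γ k i i ≤ C * τ ^ 4 * γ * k / (p * n)) ∧
          (∀ i j, i ≠ j →
            |Parr n p X γ k i i i j - tM n p X γ k i j| ≤
              C * τ ^ 4 * γ * k / (p * (n : ℝ) ^ ((3 : ℝ) / 2)))) ∧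
        -- (c) E_{st} = Σ_i P(x_i² x_s x_t) is PSD and small
        ((Matrix.of fun s t => ∑ i, Parr n p X γ k i i s t).PosSemidef ∧
          (∀ s, (∑ i, Parr n p X γ k i i s s) ≤ C * τ ^ 2 * γ * k / n) ∧
          (∀ s t, s ≠ t →
            |∑ i, Parr n p X γ k i i s t| ≤ C * τ ^ 2 * γ * k / (n : ℝ) ^ ((3 : ℝ) / 2))) ∧
        -- (d) ℓ¹ sparsity bound
        (∑ i, ∑ j, ∑ s, ∑ t, |Parr n p X γ k i j s t|) ≤ (k : ℝ) ^ 4 / 3 := by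
  refine ⟨10, 1, by norm_num, by norm_num, ?_⟩
  intro n p k γ τ ε hn hk hτ hγ _ _ hp hkC _ _ X h
  have hn1 : (1 : ℝ) ≤ n := by exact_mod_cast hn
  have hγn : 1 ≤ γ * n := one_le_mul_of_one_le_of_one_le hγ hn1
  have hnp : n ≤ p := by
    have : (n : ℝ) ≤ p := by
      have h1 : 1.1 * γ * n ≤ p := hp ▸ Nat.le_ceil _
      nlinarith
    exact_mod_cast this
  have hp2 : (p : ℝ) ≤ 2.1 * γ * n := by
    have h1 : (p : ℝ) < 1.1 * γ * n + 1 := hp ▸ Nat.ceil_lt_add_one (by positivity)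
    linarith
  have hp0 : 0 < p := hn.trans_le hnp
  have hc : 0 ≤ γ * k := by positivity
  have hpr : (0 : ℝ) < p := by exact_mod_cast hp0
  refine ⟨posSemidef_Parr hc, ⟨fun i => ?_, fun i j hij => ?_⟩,
    ⟨posSemidef_sum_Parr hc, fun s => ?_, fun s t hst => ?_⟩, ?_⟩
  · rw [Parr_diag_sub_tM h hn hp0]
    refine ⟨by positivity, ?_⟩
    refine (mul_le_mul_of_nonneg_left (h.sum_erase_pow_four_le i) (by positivity)).trans ?_
    calc _ = 1 * τ ^ 4 * γ * k / (p * n) := by field_simp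
      _ ≤ _ := by gcongr; norm_num
  · refine (h.abs_Parr_offdiag_sub_tM_le hn hnp hτ hc hij).trans ?_
    gcongr
    norm_num
  · refine (h.sum_Parr_diag_le hn hnp hτ hc s).trans ?_
    gcongr
    norm_num
  · refine (h.abs_sum_Parr_offdiag_le hn hp0 hτ hc hst).trans ?_
    gcongr
    linarith [sq_nonneg τ]
  · exact (h.sum_abs_Parr_le hn hnp hτ hc).trans
      (l1_bound_le hn1 (by positivity) hτ hγ (by positivity) hp2 hkC)

end
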